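/- Let l, n ∈ ℕ. Then the Abel sum of the series ∑_{ν=0}^∞ (−1)^ν (n+ν+2)_l exists and equals the finite sum ∑_{j=0}^l (−1)^j · (l!/(l−j)!) · (n+j+2)_{l−j} · 2^{−(j+1)}; that is, lim_{x→1⁻} ∑_{ν=0}^∞ (−1)^ν (n+ν+2)_l x^ν = ∑_{j=0}^l (−1)^j (l!/(l−j)!) (n+j+2)_{l−j} (1/2)^{j+1}. In particular this Abel sum is a polynomial of degree l in n. -/

import Mathlib

open Filter Topology

noncomputable def auxS (l : ℕ) (a : ℝ) : ℝ :=
  ∑ j ∈ Finset.range (l + 1),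
        (-1 : ℝ) ^ j * ((l.factorial : ℝ) / ((l - j).factorial : ℝ)) *
          (ascPochhammer ℝ (l - j)).eval (a + (j : ℝ)) * (1 / 2) ^ (j + 1)

lemma auxS_succ (l : ℕ) (a : ℝ) :
    auxS (l + 1) a = (ascPochhammer ℝ (l + 1)).eval a / 2 - (l + 1) / 2 * auxS l (a + 1) := by
  unfold auxS
  rw [Finset.sum_range_succ', Finset.mul_sum, add_comm, sub_eq_add_neg, ← Finset.sum_neg_distrib]
  congr 1
  · have : ((l + 1).factorial : ℝ) ≠ 0 := by positivity
    simp [this]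
    ring
  · apply Finset.sum_congr rfl
    intro j _
    rw [Nat.add_sub_add_right, Nat.factorial_succ]
    push_cast
    rw [show a + ((j : ℝ) + 1) = a + 1 + j by ring]
    ring

lemma aux_left (l : ℕ) (a : ℝ) :
    (ascPochhammer ℝ (l + 1)).eval a = a * (ascPochhammer ℝ l).eval (a + 1) := by
  rw [ascPochhammer_succ_left]
  simp

lemma aux_diff (l : ℕ) (a : ℝ) :
    (ascPochhammer ℝ (l + 1)).eval (a + 1) =
      (ascPochhammer ℝ (l + 1)).eval a + (l + 1) * (ascPochhammer ℝ l).eval (a + 1) := by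
  rw [aux_left l a, ascPochhammer_succ_right]
  simp
  ring

lemma aux_summable_poly (p : Polynomial ℝ) (r : ℝ) (hr : ‖r‖ < 1) :
    Summable (fun ν : ℕ => p.eval (ν : ℝ) * r ^ ν) := by
  induction p using Polynomial.induction_on' with
  | add p q hp hq =>
    simpa [add_mul] using hp.add hq
  | monomial k c =>
    have := (summable_pow_mul_geometric_of_norm_lt_one k hr).mul_left c
    simpa [mul_assoc] using this

lemma aux_summable (l : ℕ) (a x : ℝ) (hx : |x| < 1) :
    Summable (fun ν : ℕ => (-1 : ℝ) ^ ν * (ascPochhammer ℝ l).eval (a + (ν : ℝ)) * x ^ ν) := by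
  have := aux_summable_poly ((ascPochhammer ℝ l).comp (Polynomial.X + Polynomial.C a)) (-x)
    (by simpa using hx)
  refine this.congr fun ν => ?_
  rw [neg_pow x ν]
  simp only [Polynomial.eval_comp, Polynomial.eval_add, Polynomial.eval_X, Polynomial.eval_C]
  rw [add_comm (ν : ℝ) a]
  ring

noncomputable def auxF (l : ℕ) (a x : ℝ) : ℝ :=
  ∑' ν : ℕ, (-1 : ℝ) ^ ν * (ascPochhammer ℝ l).eval (a + (ν : ℝ)) * x ^ ν

lemma auxF_shift (l : ℕ) (a x : ℝ) (hx : |x| < 1) :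
    auxF l a x = (ascPochhammer ℝ l).eval a - x * auxF l (a + 1) x := by
  unfold auxF
  rw [(aux_summable l a x hx).tsum_eq_zero_add, ← tsum_mul_left, sub_eq_add_neg, ← tsum_neg]
  congr 1
  · simp
  · congr 1
    ext ν
    push_cast
    rw [show a + ((ν : ℝ) + 1) = a + 1 + ν by ring]
    ring

lemma auxF_diff (l : ℕ) (a x : ℝ) (hx : |x| < 1) :
    auxF (l + 1) (a + 1) x = auxF (l + 1) a x + (l + 1) * auxF l (a + 1) x := by
  unfold auxF
  rw [← tsum_mul_left, ← (aux_summable (l + 1) a x hx).tsum_add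
    ((aux_summable l (a + 1) x hx).mul_left _)]
  congr 1
  ext ν
  rw [show a + 1 + (ν : ℝ) = a + ν + 1 by ring, aux_diff]
  ring

lemma aux_ev : ∀ᶠ x : ℝ in 𝓝[<] (1 : ℝ), 0 < x ∧ |x| < 1 := by
  filter_upwards [Ioo_mem_nhdsLT (zero_lt_one' ℝ)] with x hx
  exact ⟨hx.1, by rw [abs_of_pos hx.1]; exact hx.2⟩

lemma aux_tendsto (l : ℕ) : ∀ a : ℝ, Tendsto (auxF l a) (𝓝[<] (1 : ℝ)) (𝓝 (auxS l a)) := by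
  have hid : Tendsto (fun x : ℝ => x) (𝓝[<] (1 : ℝ)) (𝓝 1) := tendsto_nhdsWithin_of_tendsto_nhds tendsto_id
  have h1 : Tendsto (fun x : ℝ => 1 + x) (𝓝[<] (1 : ℝ)) (𝓝 (1 + 1)) := hid.const_add 1
  induction l with
  | zero =>
    intro a
    have h2 : Tendsto (fun x : ℝ => 1 / (1 + x)) (𝓝[<] (1 : ℝ)) (𝓝 (1 / (1 + 1))) :=
      tendsto_const_nhds.div h1 (by norm_num)
    have e : auxS 0 a = 1 / (1 + 1) := by
      simp [auxS]
      norm_num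
    rw [e]
    refine h2.congr' ?_
    filter_upwards [aux_ev] with x hx
    have h := auxF_shift 0 a x hx.2
    have h' : auxF 0 (a + 1) x = auxF 0 a x := by simp [auxF]
    rw [h'] at h
    simp at h
    have := hx.1
    rw [div_eq_iff (by positivity)]
    linarith
  | succ l ih =>
    intro a
    rw [auxS_succ]
    have h2 : Tendsto (fun x : ℝ => ((ascPochhammer ℝ (l + 1)).eval a
        - x * ((l + 1) * auxF l (a + 1) x)) / (1 + x)) (𝓝[<] (1 : ℝ))
        (𝓝 (((ascPochhammer ℝ (l + 1)).eval a
        - 1 * ((l + 1) * auxS l (a + 1))) / (1 + 1))) :=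
      ((hid.mul ((ih (a + 1)).const_mul _)).const_sub _).div h1 (by norm_num)
    have e : (ascPochhammer ℝ (l + 1)).eval a / 2 - (l + 1) / 2 * auxS l (a + 1) =
      (((ascPochhammer ℝ (l + 1)).eval a - 1 * ((l + 1) * auxS l (a + 1))) / (1 + 1)) := by
      ring
    rw [e]
    refine h2.congr' ?_
    filter_upwards [aux_ev] with x hx
    have h := auxF_shift (l + 1) a x hx.2
    rw [auxF_diff l a x hx.2] at h
    have := hx.1
    rw [div_eq_iff (by positivity)]
    linarith

lemma aux_poly (l : ℕ) : ∃ p : Polynomial ℝ, p.degree = (l : WithBot ℕ) ∧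
    ∀ a : ℝ, auxS l a = p.eval a := by
  induction l with
  | zero =>
    refine ⟨Polynomial.C (1 / 2), Polynomial.degree_C (by norm_num), fun a => ?_⟩
    simp [auxS]
  | succ l ih =>
    obtain ⟨p, hp, he⟩ := ih
    refine ⟨Polynomial.C (1 / 2) * ascPochhammer ℝ (l + 1) -
      Polynomial.C (((l : ℝ) + 1) / 2) * p.comp (Polynomial.X + Polynomial.C 1), ?_, fun a => ?_⟩
    · have d1 : (Polynomial.C (1 / 2 : ℝ) * ascPochhammer ℝ (l + 1)).degree
          = ((l + 1 : ℕ) : WithBot ℕ) := by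
        rw [Polynomial.degree_C_mul (by norm_num),
          Polynomial.degree_eq_natDegree (monic_ascPochhammer ℝ (l + 1)).ne_zero,
          ascPochhammer_natDegree]
      have d2 : (Polynomial.C (((l : ℝ) + 1) / 2) * p.comp (Polynomial.X + Polynomial.C 1)).degree
          = (l : WithBot ℕ) := by
        rw [Polynomial.degree_C_mul (by positivity), ← Polynomial.taylor_apply, Polynomial.degree_taylor, hp]
      rw [Polynomial.degree_sub_eq_left_of_degree_lt, d1]
      rw [d1, d2]
      exact_mod_cast Nat.lt_succ_self l
    · rw [auxS_succ, he]
      simp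
      ring

/-- The Abel sum of the series `∑_ν (-1)^ν (n+ν+2)_l` exists and equals the finite
sum `∑_{j=0}^l (-1)^j (l!/(l-j)!) (n+j+2)_{l-j} (1/2)^{j+1}`; in particular this Abel
sum is a polynomial of degree `l` in `n`. -/
theorem stmt_17 (l n : ℕ) :
    Tendsto
      (fun x : ℝ =>
        ∑' ν : ℕ, (-1 : ℝ) ^ ν * (ascPochhammer ℝ l).eval ((n : ℝ) + (ν : ℝ) + 2) * x ^ ν)
      (𝓝[<] (1 : ℝ))
      (𝓝 (∑ j ∈ Finset.range (l + 1),
        (-1 : ℝ) ^ j * ((l.factorial : ℝ) / ((l - j).factorial : ℝ)) *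
          (ascPochhammer ℝ (l - j)).eval ((n : ℝ) + (j : ℝ) + 2) * (1 / 2) ^ (j + 1))) ∧
    ∃ p : Polynomial ℝ, p.degree = (l : WithBot ℕ) ∧ ∀ m : ℕ,
      (∑ j ∈ Finset.range (l + 1),
        (-1 : ℝ) ^ j * ((l.factorial : ℝ) / ((l - j).factorial : ℝ)) *
          (ascPochhammer ℝ (l - j)).eval ((m : ℝ) + (j : ℝ) + 2) * (1 / 2) ^ (j + 1))
        = p.eval (m : ℝ) := by
  have key : ∀ m : ℕ, (∑ j ∈ Finset.range (l + 1),
        (-1 : ℝ) ^ j * ((l.factorial : ℝ) / ((l - j).factorial : ℝ)) *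
          (ascPochhammer ℝ (l - j)).eval ((m : ℝ) + (j : ℝ) + 2) * (1 / 2) ^ (j + 1))
        = auxS l ((m : ℝ) + 2) := by
    intro m
    unfold auxS
    simp only [add_right_comm (m : ℝ) _ 2]
  refine ⟨?_, ?_⟩
  · rw [key]
    refine (aux_tendsto l ((n : ℝ) + 2)).congr fun x => ?_
    unfold auxF
    simp only [add_right_comm (n : ℝ) _ 2]
  · obtain ⟨p, hp, he⟩ := aux_poly l
    refine ⟨p.comp (Polynomial.X + Polynomial.C 2), ?_, fun m => ?_⟩
    · rw [← Polynomial.taylor_apply, Polynomial.degree_taylor, hp]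
    · rw [key, he]
      simp
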